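/- arXiv:2502.08457 — 2 statements merged into one kernel-verified Lean document; each statement's English description precedes it below -/
import Mathlib

section
/- Let Ω be a compact subset of ℝ^d, Z a measurable space, and t : Ω × Z × Z → ℝ a parametric family of measurable functions that are symmetric in their two Z-arguments (t_ω(z, z') = t_ω(z', z)), uniformly bounded by M > 0, and such that ω ↦ t_ω(z, z') is L-Lipschitz for every (z, z'). Let 𝔻 be a probability measure on Z, let z_1, …, z_n be i.i.d. samples from 𝔻, and define the statistic τ_ω := E_{z,z'∼𝔻⊗𝔻}[t_ω(z, z')] + (1/n²)Σ_{i,j=1}^n t_ω(z_i, z_j) − (2/n)Σ_{i=1}^n E_{z∼𝔻}[t_ω(z, z_i)]. Then there exists a constant c(Ω) ≥ 1 depending only on Ω and d such that E[sup_{ω∈Ω} |τ_ω|] ≤ (1/n) · c(Ω) · max(M · L · diam(Ω), M²)^{1/2}. -/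
open MeasureTheory
open scoped BigOperators

/-- A function of the coordinates whose dependence on the coordinate `a` is through a factor
`u (x a) (x b)` that is centered in its first argument integrates to zero. -/
lemma integral_pi_mul_eq_zero {Z : Type*} [MeasurableSpace Z] (μ : Measure Z)
    [IsProbabilityMeasure μ] {n : ℕ} (u : Z → Z → ℝ) (hu : ∀ z', ∫ z, u z z' ∂μ = 0)
    (a b : Fin n) (hab : b ≠ a) (G : (Fin n → Z) → ℝ)
    (hG : ∀ x y : Fin n → Z, (∀ i, i ≠ a → x i = y i) → G x = G y)
    (hint : Integrable (fun x : Fin n → Z => u (x a) (x b) * G x)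
      (Measure.pi fun _ : Fin n => μ)) :
    ∫ x : Fin n → Z, u (x a) (x b) * G x ∂(Measure.pi fun _ : Fin n => μ) = 0 := by
  cases n with
  | zero => exact a.elim0
  | succ n =>
    obtain ⟨b', rfl⟩ := Fin.exists_succAbove_eq hab
    have mp := (measurePreserving_piFinSuccAbove (fun _ : Fin (n + 1) => μ) a).symm
    have key := mp.integral_comp' (fun x : Fin (n + 1) → Z => u (x a) (x (a.succAbove b')) * G x)
    have hint' := (mp.integrable_comp_emb (MeasurableEquiv.measurableEmbedding _)).mpr hint
    rw [← key]
    refine (integral_prod_symm _ hint').trans ?_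
    refine integral_eq_zero_of_ae (Filter.Eventually.of_forall fun w => ?_)
    have hz : ∀ z z₀ : Z, G (a.insertNth z w) = G (a.insertNth z₀ w) := by
      intro z z₀
      apply hG
      intro i hi
      obtain ⟨j, rfl⟩ := Fin.exists_succAbove_eq hi
      simp
    obtain ⟨z₀⟩ := μ.nonempty_of_neZero
    have : ∀ z : Z, u (((MeasurableEquiv.piFinSuccAbove (fun _ => Z) a).symm (z, w)) a)
        (((MeasurableEquiv.piFinSuccAbove (fun _ => Z) a).symm (z, w)) (a.succAbove b')) *
          G ((MeasurableEquiv.piFinSuccAbove (fun _ => Z) a).symm (z, w)) =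
        u z (w b') * G (a.insertNth z₀ w) := by
      intro z
      rw [← hz z z₀]
      simp [MeasurableEquiv.piFinSuccAbove, Fin.insertNthEquiv]
    refine (integral_congr_ae (Filter.Eventually.of_forall this)).trans ?_
    simp [integral_mul_const, hu]

/-- The number of `m`-tuples of pairs in `Fin n` in which no value is attained by exactly one
of the `2 * m` entries is `O(n ^ m)`. -/
lemma card_filter_no_singleton_le (n m : ℕ) (hm : 0 < m) :
    (Finset.univ.filter fun p : Fin m → Fin n × Fin n =>
      ∀ x : Fin m ⊕ Fin m, ∃ y, y ≠ x ∧
        Sum.elim (fun k => (p k).1) (fun k => (p k).2) y =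
          Sum.elim (fun k => (p k).1) (fun k => (p k).2) x).card ≤ n ^ m * m ^ (2 * m) := by
  classical
  let Φ : (Fin m → Fin n) × (Fin m ⊕ Fin m → Fin m) → (Fin m → Fin n × Fin n) :=
    fun ge k => (ge.1 (ge.2 (Sum.inl k)), ge.1 (ge.2 (Sum.inr k)))
  have hcard : (Finset.univ : Finset ((Fin m → Fin n) × (Fin m ⊕ Fin m → Fin m))).card =
      n ^ m * m ^ (2 * m) := by
    simp [Fintype.card_prod, two_mul]
  rw [← hcard]
  refine (Finset.card_le_card ?_).trans (Finset.card_image_le (f := Φ))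
  intro p hp
  simp only [Finset.mem_filter, Finset.mem_univ, true_and] at hp
  set q : Fin m ⊕ Fin m → Fin n := Sum.elim (fun k => (p k).1) (fun k => (p k).2) with hq
  have h2 : 2 * (Finset.univ.image q).card ≤ (Finset.univ : Finset (Fin m ⊕ Fin m)).card := by
    apply Finset.mul_card_image_le_card
    intro b hb
    obtain ⟨x, -, rfl⟩ := Finset.mem_image.mp hb
    obtain ⟨y, hyx, hy⟩ := hp x
    exact Finset.one_lt_card.mpr ⟨y, by simp [hy], x, by simp, hyx⟩
  have hle : (Finset.univ.image q).card ≤ m := by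
    simp at h2
    omega
  have hne : Nonempty (Finset.univ.image q) :=
    ⟨⟨q (Sum.inl ⟨0, hm⟩), Finset.mem_image_of_mem _ (Finset.mem_univ _)⟩⟩
  obtain ⟨f⟩ := Function.Embedding.nonempty_of_card_le
    (α := (Finset.univ.image q)) (β := Fin m) (by rwa [Fintype.card_coe, Fintype.card_fin])
  refine Finset.mem_image.mpr ⟨(fun k => (Function.invFun f k : Finset.univ.image q),
    fun x => f ⟨q x, Finset.mem_image_of_mem _ (Finset.mem_univ _)⟩), Finset.mem_univ _, ?_⟩
  funext k
  simp only [Φ, Function.leftInverse_invFun f.injective _]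
  simp [hq]

/-- Moment bound for degenerate V-statistics of order two. -/
lemma integral_sum_sum_pow_le {Z : Type*} [MeasurableSpace Z] (μ : Measure Z)
    [IsProbabilityMeasure μ] (h : Z → Z → ℝ) (B : ℝ)
    (hB : ∀ z z', |h z z'| ≤ B) (hmeas : Measurable fun zz : Z × Z => h zz.1 zz.2)
    (hl : ∀ z', ∫ z, h z z' ∂μ = 0) (hr : ∀ z, ∫ z', h z z' ∂μ = 0) (n m : ℕ) (hm : 0 < m) :
    ∫ x : Fin n → Z, (∑ i, ∑ j, h (x i) (x j)) ^ m ∂(Measure.pi fun _ : Fin n => μ) ≤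
      n ^ m * m ^ (2 * m) * B ^ m := by
  classical
  have hmeasij : ∀ i j : Fin n, Measurable fun x : Fin n → Z => h (x i) (x j) := fun i j =>
    hmeas.comp (f := fun x : Fin n → Z => (x i, x j))
      ((measurable_pi_apply i).prodMk (measurable_pi_apply j))
  have hexp : ∀ x : Fin n → Z, (∑ i, ∑ j, h (x i) (x j)) ^ m =
      ∑ p : Fin m → Fin n × Fin n, ∏ k, h (x (p k).1) (x (p k).2) := by
    intro x
    rw [← Fintype.sum_pow (fun ij : Fin n × Fin n => h (x ij.1) (x ij.2)),
      Fintype.sum_prod_type]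
  have hbd : ∀ (p : Fin m → Fin n × Fin n) (x : Fin n → Z),
      ‖∏ k, h (x (p k).1) (x (p k).2)‖ ≤ B ^ m := by
    intro p x
    rw [norm_prod]
    refine (Finset.prod_le_prod (fun _ _ => norm_nonneg _) (fun k _ => hB _ _)).trans ?_
    simp
  have hint : ∀ p : Fin m → Fin n × Fin n,
      Integrable (fun x : Fin n → Z => ∏ k, h (x (p k).1) (x (p k).2))
        (Measure.pi fun _ : Fin n => μ) := by
    intro p
    refine Integrable.of_bound ?_ (B ^ m) (Filter.Eventually.of_forall (hbd p))
    exact (Finset.measurable_prod _ fun k _ => hmeasij _ _).aestronglyMeasurable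
  simp only [hexp]
  rw [integral_finsetSum _ fun p _ => hint p]
  set good := Finset.univ.filter fun p : Fin m → Fin n × Fin n =>
      ∀ x : Fin m ⊕ Fin m, ∃ y, y ≠ x ∧
        Sum.elim (fun k => (p k).1) (fun k => (p k).2) y =
          Sum.elim (fun k => (p k).1) (fun k => (p k).2) x with hgood
  have hzero : ∀ p ∈ Finset.univ, p ∉ good →
      ∫ x : Fin n → Z, ∏ k, h (x (p k).1) (x (p k).2) ∂(Measure.pi fun _ : Fin n => μ) = 0 := by
    intro p _ hp
    simp only [hgood, Finset.mem_filter, Finset.mem_univ, true_and] at hp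
    push Not at hp
    obtain ⟨s, hs⟩ := hp
    have hI := hint p
    have split : ∀ (k₀ : Fin m) (x : Fin n → Z), ∏ k, h (x (p k).1) (x (p k).2) =
        h (x (p k₀).1) (x (p k₀).2) * ∏ k ∈ Finset.univ.erase k₀, h (x (p k).1) (x (p k).2) :=
      fun k₀ x => (Finset.mul_prod_erase _ _ (Finset.mem_univ k₀)).symm
    cases s with
    | inl k₀ =>
      simp only [split k₀] at hI ⊢
      refine integral_pi_mul_eq_zero μ h hl _ _ (hs (Sum.inr k₀) (by simp)) _ ?_ hI
      intro x y hxy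
      refine Finset.prod_congr rfl fun k hk => ?_
      have e₁ : x (p k).1 = y (p k).1 :=
        hxy _ (hs (Sum.inl k) (by simpa using Finset.ne_of_mem_erase hk))
      have e₂ : x (p k).2 = y (p k).2 := hxy _ (hs (Sum.inr k) (by simp))
      rw [e₁, e₂]
    | inr k₀ =>
      simp only [split k₀] at hI ⊢
      refine integral_pi_mul_eq_zero μ (fun z z' => h z' z) hr _ _
        (hs (Sum.inl k₀) (by simp)) _ ?_ hI
      intro x y hxy
      refine Finset.prod_congr rfl fun k hk => ?_
      have e₁ : x (p k).1 = y (p k).1 := hxy _ (hs (Sum.inl k) (by simp))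
      have e₂ : x (p k).2 = y (p k).2 :=
        hxy _ (hs (Sum.inr k) (by simpa using Finset.ne_of_mem_erase hk))
      rw [e₁, e₂]
  rw [← Finset.sum_subset (Finset.subset_univ good) hzero]
  have hBm : 0 ≤ B ^ m := by
    obtain ⟨z₀⟩ := μ.nonempty_of_neZero
    exact pow_nonneg ((abs_nonneg _).trans (hB z₀ z₀)) m
  calc ∑ p ∈ good, ∫ x : Fin n → Z, ∏ k, h (x (p k).1) (x (p k).2)
        ∂(Measure.pi fun _ : Fin n => μ) ≤ ∑ _p ∈ good, B ^ m := by
        refine Finset.sum_le_sum fun p _ => (le_abs_self _).trans ?_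
        have := norm_integral_le_of_norm_le_const (μ := Measure.pi fun _ : Fin n => μ)
          (Filter.Eventually.of_forall (hbd p))
        simpa using this
    _ = good.card * B ^ m := by simp
    _ ≤ n ^ m * m ^ (2 * m) * B ^ m := by
        refine mul_le_mul_of_nonneg_right ?_ hBm
        exact_mod_cast card_filter_no_singleton_le n m hm

/-- A compact subset of `ℝ ^ d` has nets of radius `diam Ω / 4 ^ k` and size `O((4 ^ k) ^ d)`. -/
lemma IsCompact.exists_finset_net {d : ℕ} {Ω : Set (EuclideanSpace ℝ (Fin d))}
    (hΩ : IsCompact Ω) (hne : Ω.Nonempty) :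
    ∃ A : ℝ, 1 ≤ A ∧ ∀ k : ℕ, ∃ N : Finset (EuclideanSpace ℝ (Fin d)), (↑N ⊆ Ω) ∧
      (∀ ω ∈ Ω, ∃ s ∈ N, ‖ω - s‖ ≤ Metric.diam Ω / 4 ^ k) ∧ (N.card : ℝ) ≤ A * (4 ^ k) ^ d := by
  classical
  obtain ⟨ω₀, hω₀⟩ := hne
  rcases (Metric.diam_nonneg (s := Ω)).eq_or_lt with hD | hD
  · refine ⟨1, le_rfl, fun k => ⟨{ω₀}, by simpa using hω₀, fun ω hω => ⟨ω₀, by simp, ?_⟩, ?_⟩⟩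
    · have := Metric.dist_le_diam_of_mem hΩ.isBounded hω hω₀
      rw [dist_eq_norm, ← hD] at this
      simpa [← hD] using this
    · have : (1 : ℝ) ≤ (4 ^ k) ^ d := one_le_pow₀ (one_le_pow₀ (by norm_num))
      simpa using this
  obtain ⟨B, hB⟩ := hΩ.isBounded.exists_norm_le
  set D := Metric.diam Ω with hDdef
  have hB0 : 0 ≤ B := (norm_nonneg _).trans (hB ω₀ hω₀)
  have hsq : Real.sqrt d ≤ d + 1 := by
    rw [Real.sqrt_le_left (by positivity)]
    nlinarith [(Nat.cast_nonneg d : (0 : ℝ) ≤ d)]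
  set c : ℝ := (d + 1) / D with hc
  have hc0 : 0 < c := by positivity
  refine ⟨(2 * (B * c) + 3) ^ d, one_le_pow₀ (by nlinarith [mul_nonneg hB0 hc0.le]), fun k => ?_⟩
  have h4 : (1 : ℝ) ≤ 4 ^ k := one_le_pow₀ (by norm_num)
  let f : EuclideanSpace ℝ (Fin d) → (Fin d → ℤ) := fun ω i => ⌊ω i * (c * 4 ^ k)⌋
  let box : Finset (Fin d → ℤ) :=
    Fintype.piFinset fun _ => Finset.Icc (-⌈B * c * 4 ^ k⌉) ⌈B * c * 4 ^ k⌉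
  have hcoord : ∀ (ω : EuclideanSpace ℝ (Fin d)) i, |ω i| ≤ ‖ω‖ := fun ω i => by
    simpa using PiLp.norm_apply_le ω i
  have hbox : ∀ ω ∈ Ω, f ω ∈ box := by
    intro ω hω
    simp only [box, f, Fintype.mem_piFinset, Finset.mem_Icc]
    intro i
    have h1 := abs_le.mp ((hcoord ω i).trans (hB ω hω))
    have h3 : 0 < c * 4 ^ k := by positivity
    constructor
    · rw [Int.le_floor]
      push_cast
      nlinarith [Int.le_ceil (B * c * 4 ^ k), mul_le_mul_of_nonneg_right h1.1 h3.le]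
    · have h5 : (⌊ω i * (c * 4 ^ k)⌋ : ℝ) ≤ ⌈B * c * 4 ^ k⌉ := by
        nlinarith [Int.floor_le (ω i * (c * 4 ^ k)), Int.le_ceil (B * c * 4 ^ k),
          mul_le_mul_of_nonneg_right h1.2 h3.le]
      exact Int.cast_le.mp h5
  have hsub : f '' Ω ⊆ ↑box := by
    rintro _ ⟨ω, hω, rfl⟩
    exact hbox ω hω
  have hfin : (f '' Ω).Finite := box.finite_toSet.subset hsub
  obtain ⟨N, hN, hNim, hinj⟩ : ∃ N : Finset (EuclideanSpace ℝ (Fin d)), ↑N ⊆ Ω ∧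
      f '' ↑N = f '' Ω ∧ Set.InjOn f ↑N := by
    obtain ⟨u, hu, hbij⟩ := Set.SurjOn.exists_bijOn_subset (Set.surjOn_image f Ω)
    have huf : u.Finite := Set.Finite.of_finite_image (hbij.image_eq ▸ hfin) hbij.injOn
    exact ⟨huf.toFinset, by simpa using hu, by simpa using hbij.image_eq,
      by simpa using hbij.injOn⟩
  refine ⟨N, hN, fun ω hω => ?_, ?_⟩
  · obtain ⟨s, hs, hfs⟩ : f ω ∈ f '' ↑N := hNim ▸ Set.mem_image_of_mem f hω
    refine ⟨s, hs, ?_⟩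
    have hδ : ∀ i, ‖(ω - s) i‖ ≤ 1 / (c * 4 ^ k) := by
      intro i
      have := Int.abs_sub_lt_one_of_floor_eq_floor (congrFun hfs i)
      rw [← sub_mul, abs_mul, abs_of_pos (by positivity : 0 < c * 4 ^ k)] at this
      rw [le_div_iff₀ (by positivity), Real.norm_eq_abs, PiLp.sub_apply, abs_sub_comm]
      exact this.le
    rw [EuclideanSpace.norm_eq]
    calc Real.sqrt (∑ i, ‖(ω - s) i‖ ^ 2)
        ≤ Real.sqrt (∑ _i : Fin d, (1 / (c * 4 ^ k)) ^ 2) := by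
          gcongr with i
          exact hδ i
      _ = Real.sqrt d * (1 / (c * 4 ^ k)) := by
          rw [Finset.sum_const, Finset.card_univ, Fintype.card_fin, nsmul_eq_mul,
            Real.sqrt_mul (by positivity), Real.sqrt_sq (by positivity)]
      _ ≤ (d + 1) * (1 / (c * 4 ^ k)) := by gcongr
      _ = D / 4 ^ k := by
          rw [hc]
          field_simp
  · have hcard : N.card ≤ box.card := by
      rw [← Finset.card_image_of_injOn hinj]
      refine Finset.card_le_card fun y hy => hsub ?_
      rw [← hNim]
      simpa using hy
    have hnn : 0 ≤ ⌈B * c * 4 ^ k⌉ := Int.ceil_nonneg (by positivity)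
    calc (N.card : ℝ) ≤ box.card := by exact_mod_cast hcard
      _ = (2 * (⌈B * c * 4 ^ k⌉ : ℝ) + 1) ^ d := by
          simp only [box, Fintype.card_piFinset, Int.card_Icc, Finset.prod_const,
            Finset.card_univ, Fintype.card_fin]
          push_cast
          congr 1
          rw [← Int.cast_natCast, Int.toNat_of_nonneg (by omega)]
          push_cast
          ring
      _ ≤ ((2 * (B * c) + 3) * 4 ^ k) ^ d := by
          have := (Int.ceil_lt_add_one (B * c * 4 ^ k)).le
          have h0 : (0 : ℝ) ≤ ⌈B * c * 4 ^ k⌉ := by exact_mod_cast hnn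
          gcongr
          nlinarith
      _ = _ := mul_pow _ _ _

lemma le_add_pow_div {x l : ℝ} (hx : 0 ≤ x) (hl : 0 < l) (p : ℕ) :
    x ≤ l + x ^ (p + 1) / l ^ p := by
  rcases le_total x l with h | h
  · have : 0 ≤ x ^ (p + 1) / l ^ p := by positivity
    linarith
  · have : x ≤ x ^ (p + 1) / l ^ p := by
      rw [le_div_iff₀ (by positivity), pow_succ']
      gcongr
    linarith

/-- Deterministic chaining along a sequence of nets. -/
lemma abs_le_add_sum_of_chain {E : Type*} (f : E → ℝ) (N : ℕ → Finset E) (π : ℕ → E → E)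
    (hπ : ∀ i, ∀ s ∈ N (i + 1), π i s ∈ N i) (U₀ : ℝ) (U : ℕ → ℝ)
    (h₀ : ∀ s ∈ N 0, |f s| ≤ U₀) (hU : ∀ i, ∀ s ∈ N (i + 1), |f s - f (π i s)| ≤ U i) (J : ℕ) :
    ∀ s ∈ N J, |f s| ≤ U₀ + ∑ i ∈ Finset.range J, U i := by
  induction J with
  | zero => simpa using h₀
  | succ J ih =>
    intro s hs
    have h1 := ih _ (hπ J s hs)
    have h2 := hU J s hs
    have h3 := abs_add_le (f s - f (π J s)) (f (π J s))
    rw [sub_add_cancel] at h3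
    rw [Finset.sum_range_succ]
    linarith

/-- Integral of the `p`-th moment surrogate for a finite maximum. -/
lemma integral_add_sum_pow_div_le {α E : Type*} [MeasurableSpace α] (μ : Measure α)
    [IsProbabilityMeasure μ] (N : Finset E) (Y : E → α → ℝ) (p : ℕ) (B a : ℝ) (hB : 0 < B)
    (ha : 0 < a) (hY : ∀ s ∈ N, Integrable (fun x => |Y s x| ^ (p + 1)) μ)
    (hYB : ∀ s ∈ N, ∫ x, |Y s x| ^ (p + 1) ∂μ ≤ B ^ (p + 1)) (hN : (N.card : ℝ) ≤ a ^ (p + 1)) :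
    Integrable (fun x => a * B + (∑ s ∈ N, |Y s x| ^ (p + 1)) / (a * B) ^ p) μ ∧
    ∫ x, (a * B + (∑ s ∈ N, |Y s x| ^ (p + 1)) / (a * B) ^ p) ∂μ ≤ 2 * (a * B) := by
  have hsum : Integrable (fun x => (∑ s ∈ N, |Y s x| ^ (p + 1)) / (a * B) ^ p) μ :=
    (integrable_finsetSum _ hY).div_const _
  refine ⟨(integrable_const _).add hsum, ?_⟩
  rw [integral_add (integrable_const _) hsum, integral_div, integral_finsetSum _ hY]
  have h1 : ∑ s ∈ N, ∫ x, |Y s x| ^ (p + 1) ∂μ ≤ (a * B) ^ (p + 1) :=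
    calc ∑ s ∈ N, ∫ x, |Y s x| ^ (p + 1) ∂μ ≤ ∑ _s ∈ N, B ^ (p + 1) := Finset.sum_le_sum hYB
      _ = N.card * B ^ (p + 1) := by simp
      _ ≤ a ^ (p + 1) * B ^ (p + 1) := by gcongr
      _ = (a * B) ^ (p + 1) := (mul_pow _ _ _).symm
  have h2 : (∑ s ∈ N, ∫ x, |Y s x| ^ (p + 1) ∂μ) / (a * B) ^ p ≤ a * B := by
    rw [div_le_iff₀ (by positivity), ← pow_succ']
    exact h1
  simp only [integral_const, probReal_univ, smul_eq_mul, one_mul]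
  linarith

/-- Chaining bound for a process with `p`-th moment increments, `p = 2 * d + 2`, over a set with
`d`-dimensional nets. -/
lemma integral_iSup_abs_le_of_moments {E α : Type*} [SeminormedAddCommGroup E]
    [MeasurableSpace α] (μ : Measure α) [IsProbabilityMeasure μ] {Ω : Set E} (hne : Ω.Nonempty)
    {d : ℕ} {A : ℝ} (hA : 1 ≤ A)
    (hnet : ∀ k : ℕ, ∃ N : Finset E, (↑N ⊆ Ω) ∧
      (∀ ω ∈ Ω, ∃ s ∈ N, ‖ω - s‖ ≤ Metric.diam Ω / 4 ^ k) ∧ (N.card : ℝ) ≤ A * (4 ^ k) ^ d)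
    (X : E → α → ℝ) (hX : ∀ ω, Measurable (X ω)) {R K C M L : ℝ} (hR : ∀ ω x, |X ω x| ≤ R)
    (hK : 0 ≤ K) (hLip : ∀ x ω ω', |X ω x - X ω' x| ≤ K * ‖ω - ω'‖) (hC : 0 < C) (hM : 0 < M)
    (hL : 0 < L) (h₀ : ∀ ω, ∫ x, |X ω x| ^ (2 * d + 1 + 1) ∂μ ≤ (C * M) ^ (2 * d + 1 + 1))
    (h₁ : ∀ ω ω', ∫ x, |X ω x - X ω' x| ^ (2 * d + 1 + 1) ∂μ ≤
      (C * (L * ‖ω - ω'‖)) ^ (2 * d + 1 + 1)) :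
    ∫ x, (⨆ ω : Ω, |X ω x|) ∂μ ≤
      20 * A * C * Real.sqrt (max (M * L * Metric.diam Ω) (M ^ 2)) := by
  classical
  set D := Metric.diam Ω with hD
  have hD0 : 0 ≤ D := Metric.diam_nonneg
  have hex : ∃ k : ℕ, L * D ≤ M * 4 ^ k := by
    obtain ⟨k, hk⟩ := pow_unbounded_of_one_lt (L * D / M) (by norm_num : (1 : ℝ) < 4)
    rw [div_lt_iff₀ hM] at hk
    exact ⟨k, by linarith⟩
  obtain ⟨k₀, hk₀, hk₀'⟩ : ∃ k₀ : ℕ, L * D ≤ M * 4 ^ k₀ ∧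
      M * 2 ^ k₀ ≤ 2 * Real.sqrt (max (M * L * D) (M ^ 2)) := by
    refine ⟨Nat.find hex, Nat.find_spec hex, ?_⟩
    have : M * 2 ^ Nat.find hex / 2 ≤ Real.sqrt (max (M * L * D) (M ^ 2)) := by
      rw [Real.le_sqrt' (by positivity)]
      rcases h : Nat.find hex with _ | k
      · refine le_max_of_le_right ?_
        nlinarith [sq_nonneg M]
      · refine le_max_of_le_left ?_
        have hlt := Nat.find_min hex (m := k) (by omega)
        push Not at hlt
        have e : (2 : ℝ) ^ k * 2 ^ k = 4 ^ k := by
          rw [← mul_pow]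
          norm_num
        calc (M * 2 ^ (k + 1) / 2) ^ 2 = M * (M * (2 ^ k * 2 ^ k)) := by ring
          _ ≤ M * (L * D) := by
            rw [e]
            exact mul_le_mul_of_nonneg_left hlt.le hM.le
          _ = M * L * D := by ring
    linarith
  choose N' hN'Ω hN'net hN'card using hnet
  let N : ℕ → Finset E := fun i => N' (k₀ + i)
  have hcard : ∀ i, ((N i).card : ℝ) ≤ (A * 2 ^ (k₀ + i)) ^ (2 * d + 1 + 1) := by
    intro i
    have h2 : (1 : ℝ) ≤ 2 ^ (k₀ + i) := one_le_pow₀ (by norm_num)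
    have e : ((4 : ℝ) ^ (k₀ + i)) ^ d = (2 ^ (k₀ + i)) ^ (2 * d) := by
      rw [pow_mul, ← pow_mul 2 _ 2, mul_comm _ 2, pow_mul 2 2]
      norm_num
    refine (hN'card _).trans ?_
    rw [mul_pow, e]
    refine mul_le_mul (le_self_pow₀ hA (by omega)) (pow_le_pow_right₀ h2 (by omega))
      (by positivity) (by positivity)
  have hnear : ∀ i, ∀ ω : E, ∃ s, ω ∈ Ω → s ∈ N i ∧ ‖ω - s‖ ≤ D / 4 ^ (k₀ + i) := by
    intro i ω
    by_cases hω : ω ∈ Ω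
    · obtain ⟨s, hs, hs'⟩ := hN'net (k₀ + i) ω hω
      exact ⟨s, fun _ => ⟨hs, hs'⟩⟩
    · exact ⟨ω, fun h => absurd h hω⟩
  choose π hπ using hnear
  have hNΩ : ∀ i, ∀ s ∈ N i, s ∈ Ω := fun i s hs => hN'Ω _ hs
  have hint₀ : ∀ ω, Integrable (fun x => |X ω x| ^ (2 * d + 1 + 1)) μ := fun ω => by
    refine Integrable.of_bound ((hX ω).abs.pow_const _).aestronglyMeasurable
      (R ^ (2 * d + 1 + 1)) (Filter.Eventually.of_forall fun x => ?_)
    rw [norm_pow, Real.norm_eq_abs, abs_abs]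
    exact pow_le_pow_left₀ (abs_nonneg _) (hR ω x) _
  have hint₁ : ∀ ω ω', Integrable (fun x => |X ω x - X ω' x| ^ (2 * d + 1 + 1)) μ :=
    fun ω ω' => by
    refine Integrable.of_bound (((hX ω).sub (hX ω')).abs.pow_const _).aestronglyMeasurable
      ((K * ‖ω - ω'‖) ^ (2 * d + 1 + 1)) (Filter.Eventually.of_forall fun x => ?_)
    rw [norm_pow, Real.norm_eq_abs, abs_abs]
    exact pow_le_pow_left₀ (abs_nonneg _) (hLip x ω ω') _
  let a : ℕ → ℝ := fun i => A * 2 ^ (k₀ + i)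
  let B : ℕ → ℝ := fun i => C * (M / 4 ^ i)
  have ha : ∀ i, 0 < a i := fun i => by positivity
  have hB : ∀ i, 0 < B i := fun i => by positivity
  let U₀ : α → ℝ := fun x => a 0 * (C * M) +
    (∑ s ∈ N 0, |X s x| ^ (2 * d + 1 + 1)) / (a 0 * (C * M)) ^ (2 * d + 1)
  let U : ℕ → α → ℝ := fun i x => a (i + 1) * B i +
    (∑ s ∈ N (i + 1), |X s x - X (π i s) x| ^ (2 * d + 1 + 1)) / (a (i + 1) * B i) ^ (2 * d + 1)
  obtain ⟨hU₀int, hU₀⟩ : Integrable U₀ μ ∧ ∫ x, U₀ x ∂μ ≤ 2 * (a 0 * (C * M)) :=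
    integral_add_sum_pow_div_le μ (N 0) X (2 * d + 1) (C * M) (a 0) (by positivity) (ha 0)
      (fun s _ => hint₀ s) (fun s _ => h₀ s) (hcard 0)
  have hU : ∀ i, Integrable (U i) μ ∧ ∫ x, U i x ∂μ ≤ 2 * (a (i + 1) * B i) := fun i => by
    refine integral_add_sum_pow_div_le μ (N (i + 1)) (fun s x => X s x - X (π i s) x) (2 * d + 1)
      (B i) (a (i + 1)) (hB i) (ha _) (fun s _ => hint₁ _ _) (fun s hs => ?_) (hcard (i + 1))
    refine (h₁ _ _).trans (pow_le_pow_left₀ (by positivity) ?_ _)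
    refine mul_le_mul_of_nonneg_left ?_ hC.le
    calc L * ‖s - π i s‖ ≤ L * (D / 4 ^ (k₀ + i)) :=
          mul_le_mul_of_nonneg_left (hπ i s (hNΩ _ s hs)).2 hL.le
      _ = L * D / 4 ^ k₀ / 4 ^ i := by
          rw [pow_add]
          field_simp
      _ ≤ M / 4 ^ i := by
          gcongr
          rwa [div_le_iff₀ (by positivity)]
  have hpt : ∀ J x, ⨆ ω : Ω, |X ω x| ≤
      U₀ x + ∑ i ∈ Finset.range J, U i x + K * (D / 4 ^ (k₀ + J)) := by
    intro J x
    have : Nonempty Ω := hne.to_subtype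
    refine ciSup_le fun ω => ?_
    obtain ⟨hs, hs'⟩ := hπ J ω ω.2
    have hchain := abs_le_add_sum_of_chain (fun ω => X ω x) N π
      (fun i s hs => (hπ i s (hNΩ _ s hs)).1) (U₀ x) (fun i => U i x)
      (fun s hs => (le_add_pow_div (abs_nonneg _) (by positivity) (2 * d + 1)).trans <|
        add_le_add_right (div_le_div_of_nonneg_right
          (Finset.single_le_sum (f := fun s => |X s x| ^ (2 * d + 1 + 1))
            (fun _ _ => by positivity) hs)
          (pow_pos (mul_pos (ha 0) (mul_pos hC hM)) _).le) _)
      (fun i s hs => (le_add_pow_div (abs_nonneg _) (mul_pos (ha (i + 1)) (hB i))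
          (2 * d + 1)).trans <| by
        simp only [U]
        have := mul_pos (ha (i + 1)) (hB i)
        gcongr
        exact Finset.single_le_sum (f := fun s => |X s x - X (π i s) x| ^ (2 * d + 1 + 1))
          (fun _ _ => by positivity) hs) J _ hs
    have h3 := abs_add_le (X ω x - X (π J ω) x) (X (π J ω) x)
    rw [sub_add_cancel] at h3
    have h4 := (hLip x ω (π J ω)).trans (mul_le_mul_of_nonneg_left hs' hK)
    linarith
  have hsum : ∀ J : ℕ, ∑ i ∈ Finset.range J, 2 * (a (i + 1) * B i) ≤
      8 * (A * C * (M * 2 ^ k₀)) := by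
    intro J
    have e : ∀ i, 2 * (a (i + 1) * B i) = 4 * (A * C * (M * 2 ^ k₀)) * (1 / 2) ^ i := by
      intro i
      have : (4 : ℝ) ^ i = 2 ^ i * 2 ^ i := by
        rw [← mul_pow]
        norm_num
      simp only [a, B, this, one_div, inv_pow, pow_add, pow_one]
      field_simp
      ring
    simp only [e]
    rw [← Finset.mul_sum]
    have h2 : ∑ i ∈ Finset.range J, (1 / 2 : ℝ) ^ i ≤ 2 := sum_geometric_two_le J
    have : 0 ≤ 4 * (A * C * (M * 2 ^ k₀)) := by positivity
    nlinarith
  have hJ : ∀ J : ℕ, ∫ x, (⨆ ω : Ω, |X ω x|) ∂μ ≤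
      10 * (A * C * (M * 2 ^ k₀)) + K * (D / 4 ^ (k₀ + J)) := by
    intro J
    have hI : Integrable (fun x => ∑ i ∈ Finset.range J, U i x) μ :=
      integrable_finsetSum _ fun i _ => (hU i).1
    have hI2 : Integrable (fun x => U₀ x + ∑ i ∈ Finset.range J, U i x) μ := hU₀int.add hI
    refine (integral_mono_of_nonneg
      (Filter.Eventually.of_forall fun x => Real.iSup_nonneg fun _ => abs_nonneg _)
      (hI2.add (integrable_const (K * (D / 4 ^ (k₀ + J)))))
      (Filter.Eventually.of_forall (hpt J))).trans ?_
    simp only [Pi.add_apply]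
    rw [integral_add hI2 (integrable_const _), integral_add hU₀int hI,
      integral_finsetSum _ fun i _ => (hU i).1]
    have h5 := (Finset.sum_le_sum fun i (_ : i ∈ Finset.range J) => (hU i).2).trans (hsum J)
    have h6 : 2 * (a 0 * (C * M)) = 2 * (A * C * (M * 2 ^ k₀)) := by
      simp only [a, add_zero]
      ring
    simp only [integral_const, probReal_univ, smul_eq_mul, one_mul]
    linarith
  have hlim : Filter.Tendsto
      (fun J : ℕ => 10 * (A * C * (M * 2 ^ k₀)) + K * (D / 4 ^ (k₀ + J))) Filter.atTop
      (nhds (10 * (A * C * (M * 2 ^ k₀)) + K * 0)) := by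
    refine Filter.Tendsto.const_add _ (Filter.Tendsto.const_mul _ ?_)
    refine Filter.Tendsto.div_atTop tendsto_const_nhds ?_
    have := tendsto_pow_atTop_atTop_of_one_lt (by norm_num : (1 : ℝ) < 4)
    exact this.comp (Filter.tendsto_atTop_mono (fun J => Nat.le_add_left J k₀) Filter.tendsto_id)
  have hfin := ge_of_tendsto' hlim hJ
  have : A * C * (M * 2 ^ k₀) ≤ A * C * (2 * Real.sqrt (max (M * L * D) (M ^ 2))) := by
    gcongr
  linarith

/-- The centered (doubly degenerate) version of a symmetric kernel. -/
noncomputable def centeredKernel {Z : Type*} [MeasurableSpace Z] (μ : Measure Z)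
    (f : Z → Z → ℝ) (z z' : Z) : ℝ :=
  f z z' - ∫ y, f y z ∂μ - ∫ y, f y z' ∂μ + ∫ y, ∫ y', f y y' ∂μ ∂μ

section CenteredKernel

variable {Z : Type*} [MeasurableSpace Z] {μ : Measure Z} {f : Z → Z → ℝ} {B : ℝ}

lemma centeredKernel_symm (hs : ∀ z z', f z z' = f z' z) (z z' : Z) :
    centeredKernel μ f z z' = centeredKernel μ f z' z := by
  simp only [centeredKernel, hs z z']
  ring

lemma mean_centeredKernel_eq (f : Z → Z → ℝ) {n : ℕ} (hn : 0 < n) (x : Fin n → Z) :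
    (1 / (n : ℝ) ^ 2) * ∑ i, ∑ j, centeredKernel μ f (x i) (x j) =
      (∫ z, ∫ z', f z z' ∂μ ∂μ) + (1 / (n : ℝ) ^ 2) * ∑ i, ∑ j, f (x i) (x j) -
        (2 / (n : ℝ)) * ∑ i, ∫ z, f z (x i) ∂μ := by
  have hn' : (n : ℝ) ≠ 0 := by positivity
  simp only [centeredKernel, Finset.sum_add_distrib, Finset.sum_sub_distrib, Finset.sum_const,
    Finset.card_univ, Fintype.card_fin, nsmul_eq_mul, ← Finset.mul_sum]
  field_simp
  ring

variable [IsProbabilityMeasure μ]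

lemma integrable_of_abs_le (hf : Measurable fun zz : Z × Z => f zz.1 zz.2)
    (hB : ∀ z z', |f z z'| ≤ B) (z' : Z) : Integrable (fun z => f z z') μ :=
  Integrable.of_bound
    (hf.comp (f := fun z => (z, z')) measurable_prodMk_right).aestronglyMeasurable B
    (Filter.Eventually.of_forall fun z => hB z z')

lemma abs_integral_le_of_abs_le {g : Z → ℝ} (hB : ∀ z, |g z| ≤ B) : |∫ z, g z ∂μ| ≤ B := by
  have := norm_integral_le_of_norm_le_const (μ := μ) (f := g) (Filter.Eventually.of_forall hB)
  simpa using this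

lemma measurable_integral_left (hf : Measurable fun zz : Z × Z => f zz.1 zz.2) :
    Measurable fun z' => ∫ z, f z z' ∂μ :=
  (StronglyMeasurable.integral_prod_left (f := f) hf.stronglyMeasurable).measurable

lemma measurable_centeredKernel (hf : Measurable fun zz : Z × Z => f zz.1 zz.2) :
    Measurable fun zz : Z × Z => centeredKernel μ f zz.1 zz.2 := by
  have h := measurable_integral_left (μ := μ) hf
  exact ((hf.sub (h.comp measurable_fst)).sub (h.comp measurable_snd)).add_const _

lemma abs_centeredKernel_le (hB : ∀ z z', |f z z'| ≤ B) (z z' : Z) :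
    |centeredKernel μ f z z'| ≤ 4 * B := by
  have h1 := abs_le.mp (hB z z')
  have h2 := abs_le.mp (abs_integral_le_of_abs_le (μ := μ) (g := fun y => f y z) fun y => hB y z)
  have h3 := abs_le.mp (abs_integral_le_of_abs_le (μ := μ) (g := fun y => f y z') fun y => hB y z')
  have h4 := abs_le.mp (abs_integral_le_of_abs_le (μ := μ) (g := fun y => ∫ y', f y y' ∂μ)
    fun y => abs_integral_le_of_abs_le (hB y))
  rw [centeredKernel, abs_le]
  constructor <;> linarith [h1.1, h1.2, h2.1, h2.2, h3.1, h3.2, h4.1, h4.2]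

lemma integral_centeredKernel (hf : Measurable fun zz : Z × Z => f zz.1 zz.2)
    (hB : ∀ z z', |f z z'| ≤ B) (hs : ∀ z z', f z z' = f z' z) (z' : Z) :
    ∫ z, centeredKernel μ f z z' ∂μ = 0 := by
  have hI1 := integrable_of_abs_le (μ := μ) hf hB z'
  have hI2 : Integrable (fun z => ∫ y, f y z ∂μ) μ :=
    Integrable.of_bound (measurable_integral_left hf).aestronglyMeasurable B
      (Filter.Eventually.of_forall fun z => abs_integral_le_of_abs_le fun y => hB y z)
  have hI3 : Integrable (fun z => f z z' - ∫ y, f y z ∂μ) μ := hI1.sub hI2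
  have hI4 : Integrable (fun z => f z z' - ∫ y, f y z ∂μ - ∫ y, f y z' ∂μ) μ :=
    hI3.sub (integrable_const _)
  have e : ∫ z, ∫ y, f y z ∂μ ∂μ = ∫ z, ∫ y, f z y ∂μ ∂μ := by
    simp_rw [fun y z => hs y z]
  simp only [centeredKernel]
  rw [integral_add hI4 (integrable_const _), integral_sub hI3 (integrable_const _),
    integral_sub hI1 hI2]
  simp only [integral_const, probReal_univ, smul_eq_mul, one_mul]
  linarith

lemma centeredKernel_sub {g : Z → Z → ℝ} {B' : ℝ}
    (hf : Measurable fun zz : Z × Z => f zz.1 zz.2)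
    (hB : ∀ z z', |f z z'| ≤ B) (hg : Measurable fun zz : Z × Z => g zz.1 zz.2)
    (hB' : ∀ z z', |g z z'| ≤ B') (hfs : ∀ z z', f z z' = f z' z)
    (hgs : ∀ z z', g z z' = g z' z) (z z' : Z) :
    centeredKernel μ (fun y y' => f y y' - g y y') z z' =
      centeredKernel μ f z z' - centeredKernel μ g z z' := by
  have key : ∀ {k : Z → Z → ℝ} {b : ℝ}, (Measurable fun zz : Z × Z => k zz.1 zz.2) →
      (∀ z z', |k z z'| ≤ b) → Integrable (fun z => ∫ y, k y z ∂μ) μ := fun hk hb =>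
    Integrable.of_bound (measurable_integral_left hk).aestronglyMeasurable _
      (Filter.Eventually.of_forall fun z => abs_integral_le_of_abs_le fun y => hb y z)
  have hf1 := integrable_of_abs_le (μ := μ) hf hB
  have hg1 := integrable_of_abs_le (μ := μ) hg hB'
  have e : ∫ y, ∫ y', (f y y' - g y y') ∂μ ∂μ =
      ∫ y, ∫ y', f y y' ∂μ ∂μ - ∫ y, ∫ y', g y y' ∂μ ∂μ := by
    have hf2 := key hf hB
    have hg2 := key hg hB'
    simp_rw [fun y z => hfs y z] at hf1 hf2
    simp_rw [fun y z => hgs y z] at hg1 hg2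
    rw [← integral_sub hf2 hg2]
    exact integral_congr_ae (Filter.Eventually.of_forall fun y => integral_sub (hf1 y) (hg1 y))
  simp only [centeredKernel]
  rw [e, integral_sub (hf1 z) (hg1 z), integral_sub (hf1 z') (hg1 z')]
  ring

/-- Moment bound for the centered V-statistic of a bounded symmetric kernel. -/
lemma integral_abs_centered_pow_le (hf : Measurable fun zz : Z × Z => f zz.1 zz.2)
    (hB : ∀ z z', |f z z'| ≤ B) (hs : ∀ z z', f z z' = f z' z) {n : ℕ} (hn : 0 < n) (d : ℕ) :
    ∫ x : Fin n → Z, |(1 / (n : ℝ)) * ∑ i, ∑ j, centeredKernel μ f (x i) (x j)| ^ (2 * d + 1 + 1)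
        ∂(Measure.pi fun _ : Fin n => μ) ≤
      (4 * (2 * d + 2) ^ 2 * B) ^ (2 * d + 1 + 1) := by
  have hev : Even (2 * d + 1 + 1) := ⟨d + 1, by ring⟩
  have hl := integral_centeredKernel (μ := μ) hf hB hs
  have hr : ∀ z, ∫ z', centeredKernel μ f z z' ∂μ = 0 := fun z => by
    simp_rw [fun z' => centeredKernel_symm (μ := μ) hs z z']
    exact hl z
  have key := integral_sum_sum_pow_le μ (centeredKernel μ f) (4 * B) (abs_centeredKernel_le hB)
    (measurable_centeredKernel hf) hl hr n (2 * d + 1 + 1) (by omega)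
  simp only [hev.pow_abs, mul_pow (1 / (n : ℝ))]
  rw [integral_const_mul]
  have hn' : (n : ℝ) ≠ 0 := by positivity
  refine (mul_le_mul_of_nonneg_left key (by positivity)).trans_eq ?_
  rw [pow_mul _ 2 (2 * d + 1 + 1), ← mul_pow, ← mul_pow, ← mul_pow]
  congr 1
  push_cast
  field_simp
  ring

end CenteredKernel

/-- Let `Ω ⊆ ℝ^d` be compact.  There exists a constant `c(Ω) ≥ 1`,
depending only on `Ω` and `d`, such that for every measurable space `Z`, every
symmetric parametric family `t : Ω × Z × Z → ℝ` uniformly bounded by `M > 0` and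
`L`-Lipschitz in `ω`, every probability measure `𝔻` on `Z` and i.i.d. samples
`z₁, …, z_n ∼ 𝔻`, the statistic
`τ_ω := E_{𝔻⊗𝔻}[t_ω] + (1/n²) Σ_{i,j} t_ω(zᵢ, zⱼ) − (2/n) Σᵢ E_z[t_ω(z, zᵢ)]`
satisfies `E[sup_{ω∈Ω} |τ_ω|] ≤ (1/n) c(Ω) max(M L diam(Ω), M²)^{1/2}`. -/
theorem stmt_13 {d : ℕ} (Ω : Set (EuclideanSpace ℝ (Fin d))) (hΩ : IsCompact Ω) :
    ∃ c : ℝ, 1 ≤ c ∧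
      ∀ (Z : Type) (_ : MeasurableSpace Z)
        (t : EuclideanSpace ℝ (Fin d) → Z → Z → ℝ) (M L : ℝ),
        0 < M → 0 < L →
        (∀ ω z z', t ω z z' = t ω z' z) →
        (∀ ω z z', |t ω z z'| ≤ M) →
        (∀ ω, Measurable fun zz : Z × Z => t ω zz.1 zz.2) →
        (∀ (z z' : Z) (ω ω' : EuclideanSpace ℝ (Fin d)),
          |t ω z z' - t ω' z z'| ≤ L * ‖ω - ω'‖) →
        ∀ (𝔻 : Measure Z), IsProbabilityMeasure 𝔻 →
        ∀ (n : ℕ), 0 < n →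
        (∫ zs : Fin n → Z,
            (⨆ ω : Ω,
              |(∫ z, ∫ z', t ω z z' ∂𝔻 ∂𝔻) +
                (1 / (n : ℝ) ^ 2) * ∑ i : Fin n, ∑ j : Fin n, t ω (zs i) (zs j) -
                (2 / (n : ℝ)) * ∑ i : Fin n, ∫ z, t ω z (zs i) ∂𝔻|)
            ∂(Measure.pi fun _ : Fin n => 𝔻)) ≤
          (1 / (n : ℝ)) * c * Real.sqrt (max (M * L * Metric.diam Ω) (M ^ 2)) := by
  rcases Ω.eq_empty_or_nonempty with rfl | hne
  · refine ⟨1, le_rfl, ?_⟩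
    intro Z _ t M L hM hL hs hB hmeas hLip 𝔻 h𝔻 n hn
    simp only [Real.iSup_of_isEmpty, integral_zero]
    positivity
  obtain ⟨A, hA, hnet⟩ := hΩ.exists_finset_net hne
  refine ⟨20 * A * (4 * (2 * d + 2) ^ 2), ?_, ?_⟩
  · have : (1 : ℝ) ≤ (2 * d + 2) ^ 2 := one_le_pow₀ (by
      linarith [(Nat.cast_nonneg d : (0 : ℝ) ≤ d)])
    nlinarith
  intro Z _ t M L hM hL hs hB hmeas hLip 𝔻 h𝔻 n hn
  have hn' : (n : ℝ) ≠ 0 := by positivity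
  let X : EuclideanSpace ℝ (Fin d) → (Fin n → Z) → ℝ := fun ω x =>
    (1 / (n : ℝ)) * ∑ i, ∑ j, centeredKernel 𝔻 (t ω) (x i) (x j)
  have hbound : ∀ {f : Z → Z → ℝ} {b : ℝ}, (∀ z z', |f z z'| ≤ b) → ∀ x : Fin n → Z,
      |(1 / (n : ℝ)) * ∑ i, ∑ j, centeredKernel 𝔻 f (x i) (x j)| ≤ 4 * n * b := by
    intro f b hb x
    rw [abs_mul, abs_of_nonneg (by positivity : 0 ≤ 1 / (n : ℝ))]
    have : |∑ i, ∑ j, centeredKernel 𝔻 f (x i) (x j)| ≤ n * (n * (4 * b)) := by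
      refine (Finset.abs_sum_le_sum_abs _ _).trans ?_
      refine (Finset.sum_le_sum fun i _ => (Finset.abs_sum_le_sum_abs _ _).trans
        (Finset.sum_le_sum fun j _ => abs_centeredKernel_le hb (x i) (x j))).trans_eq ?_
      simp
    refine (mul_le_mul_of_nonneg_left this (by positivity)).trans_eq ?_
    field_simp
  have hsub : ∀ ω ω' x, X ω x - X ω' x = (1 / (n : ℝ)) * ∑ i, ∑ j,
      centeredKernel 𝔻 (fun y y' => t ω y y' - t ω' y y') (x i) (x j) := by
    intro ω ω' x
    simp only [X, centeredKernel_sub (hmeas ω) (hB ω) (hmeas ω') (hB ω') (hs ω) (hs ω'),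
      Finset.sum_sub_distrib, mul_sub]
  have hXmeas : ∀ ω, Measurable (X ω) := by
    intro ω
    refine (Finset.measurable_sum _ fun i _ => Finset.measurable_sum _ fun j _ => ?_).const_mul _
    exact (measurable_centeredKernel (μ := 𝔻) (hmeas ω)).comp (f := fun x : Fin n → Z => (x i, x j))
      ((measurable_pi_apply i).prodMk (measurable_pi_apply j))
  have key := integral_iSup_abs_le_of_moments (Measure.pi fun _ : Fin n => 𝔻) hne hA hnet X hXmeas
    (R := 4 * n * M) (K := 4 * n * L) (C := 4 * (2 * d + 2) ^ 2) (fun ω x => hbound (hB ω) x)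
    (by positivity)
    (fun x ω ω' => by
      rw [hsub]
      refine (hbound (fun z z' => hLip z z' ω ω') x).trans_eq (by ring))
    (by positivity) hM hL
    (fun ω => integral_abs_centered_pow_le (hmeas ω) (hB ω) (hs ω) hn d)
    (fun ω ω' => by
      simp only [hsub]
      exact integral_abs_centered_pow_le ((hmeas ω).sub (hmeas ω'))
        (fun z z' => hLip z z' ω ω') (fun z z' => by rw [hs ω, hs ω']) hn d)
  have hτ : ∀ (ω : EuclideanSpace ℝ (Fin d)) (x : Fin n → Z),
      |(∫ z, ∫ z', t ω z z' ∂𝔻 ∂𝔻) + (1 / (n : ℝ) ^ 2) * ∑ i, ∑ j, t ω (x i) (x j) -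
        (2 / (n : ℝ)) * ∑ i, ∫ z, t ω z (x i) ∂𝔻| = (1 / (n : ℝ)) * |X ω x| := by
    intro ω x
    rw [← mean_centeredKernel_eq (t ω) hn x, ← abs_of_nonneg (by positivity : 0 ≤ 1 / (n : ℝ)),
      ← abs_mul]
    simp only [X]
    congr 1
    field_simp
  simp only [hτ]
  simp only [← Real.mul_iSup_of_nonneg (by positivity : 0 ≤ 1 / (n : ℝ))]
  rw [integral_const_mul, mul_assoc]
  exact mul_le_mul_of_nonneg_left key (by positivity)
end

section
/- The empirical value function F̂(ω) := L̂_out(ω, ĥ_ω) is differentiable in ω, and for every ω ∈ ℝ^d its gradient ∇F̂(ω) is equal to the plug-in estimator of the total gradient: ∇F̂(ω) = (1/m)Σ_{j=1}^m ∂_ω ℓ_out(ω, ĥ_ω(x̃_j), ỹ_j) + (1/n)Σ_{i=1}^n ∂²_{ω,v} ℓ_in(ω, ĥ_ω(x_i), y_i) â_ω(x_i), where â_ω ∈ H is the unique minimizer over H of the empirical adjoint objective a ↦ L̂_adj(ω, a) := (1/2n)Σ_{i=1}^n ∂²_v ℓ_in(ω, ĥ_ω(x_i), y_i) a(x_i)²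 + (1/m)Σ_{j=1}^m ∂_v ℓ_out(ω, ĥ_ω(x̃_j), ỹ_j) a(x̃_j) + (λ/2)‖a‖²_H. -/
open MeasureTheory
open scoped RealInnerProductSpace BigOperators

/-- `ℝ^n` as a Euclidean space. -/
abbrev Euc (n : ℕ) : Type := EuclideanSpace ℝ (Fin n)

section Helpers

variable {E H ι : Type*} [NormedAddCommGroup E] [NormedAddCommGroup H] [InnerProductSpace ℝ H]

/-- A zero of a parametrized strongly monotone map depends differentiably on the parameter at any
point where the map is differentiable with invertible partial derivative in the second variable. -/
theorem hasFDerivAt_zero_of_strongly_monotone [NormedSpace ℝ E] {G : E → H → H} {c : ℝ}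
    (hc : 0 < c) (hG : ∀ w h k, c * ‖h - k‖ ^ 2 ≤ ⟪G w h - G w k, h - k⟫)
    {x : E → H} (hx : ∀ w, G w (x w) = 0) {w₀ : E} {D : E →L[ℝ] H} {A : H ≃L[ℝ] H}
    (hD : HasFDerivAt (fun p : E × H => G p.1 p.2) (D.coprod (A : H →L[ℝ] H)) (w₀, x w₀)) :
    HasFDerivAt x (-((A.symm : H →L[ℝ] H).comp D)) w₀ := by
  set L : E →L[ℝ] H := -((A.symm : H →L[ℝ] H).comp D) with hL
  set ψ : E → H := fun w => x w₀ + L (w - w₀) with hψ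
  have hψ' : HasFDerivAt ψ L w₀ := by
    have := L.hasFDerivAt.comp (f := fun w => w - w₀) w₀ ((hasFDerivAt_id w₀).sub_const w₀)
    exact this.const_add (x w₀)
  have hψ0 : ψ w₀ = x w₀ := by simp [hψ]
  have hcomp : HasFDerivAt (fun w => G w (ψ w)) (0 : E →L[ℝ] H) w₀ := by
    have h1 : HasFDerivAt (fun w => (w, ψ w)) ((ContinuousLinearMap.id ℝ E).prod L) w₀ :=
      (hasFDerivAt_id w₀).prodMk hψ'
    rw [← hψ0] at hD
    have h2 := HasFDerivAt.comp (g := fun p : E × H => G p.1 p.2) w₀ hD h1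
    refine h2.congr_fderiv ?_
    ext u
    simp [hL]
  have hbound : ∀ w, c * ‖x w - ψ w‖ ≤ ‖G w (ψ w)‖ := by
    intro w
    have h1 := hG w (x w) (ψ w)
    rw [hx w, zero_sub] at h1
    have h2 : ⟪-G w (ψ w), x w - ψ w⟫ ≤ ‖G w (ψ w)‖ * ‖x w - ψ w‖ := by
      simpa using real_inner_le_norm (-G w (ψ w)) (x w - ψ w)
    rcases (norm_nonneg (x w - ψ w)).eq_or_lt with h0 | h0
    · rw [← h0]; simp
    · exact le_of_mul_le_mul_right (by nlinarith) h0
  have hGo := hcomp.isLittleO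
  simp only [hψ0, hx, sub_zero, zero_apply] at hGo
  refine HasFDerivAt.of_isLittleO (Asymptotics.IsBigO.trans_isLittleO ?_ hGo)
  refine Asymptotics.IsBigO.of_bound c⁻¹ (Filter.Eventually.of_forall fun w => ?_)
  have : x w - x w₀ - L (w - w₀) = x w - ψ w := by simp [hψ, sub_sub]
  rw [this, inv_mul_eq_div, le_div_iff₀ hc, mul_comm]
  exact hbound w

/-- The total derivative of a function on a product with a real line, in terms of the partial
gradient and the partial derivative. -/
theorem hasFDerivAt_coprod_gradient_deriv [InnerProductSpace ℝ E] [CompleteSpace E]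
    {f : E → ℝ → ℝ} {w : E} {v : ℝ}
    (hf : DifferentiableAt ℝ (fun p : E × ℝ => f p.1 p.2) (w, v)) :
    HasFDerivAt (fun p : E × ℝ => f p.1 p.2)
      ((innerSL ℝ (gradient (fun w' => f w' v) w)).coprod
        (ContinuousLinearMap.toSpanSingleton ℝ (deriv (fun t => f w t) v))) (w, v) := by
  have h := hf.hasFDerivAt
  have h1 : HasFDerivAt (fun w' => f w' v) ((fderiv ℝ (fun p : E × ℝ => f p.1 p.2) (w, v)).comp
      (ContinuousLinearMap.inl ℝ E ℝ)) w :=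
    h.comp (f := fun w' => (w', v)) w (hasFDerivAt_prodMk_left w v)
  have h2 : HasFDerivAt (fun t => f w t) ((fderiv ℝ (fun p : E × ℝ => f p.1 p.2) (w, v)).comp
      (ContinuousLinearMap.inr ℝ E ℝ)) v :=
    h.comp (f := fun t => (w, t)) v (hasFDerivAt_prodMk_right w v)
  refine h.congr_fderiv ?_
  refine ContinuousLinearMap.ext fun p => ?_
  have e1 : ⟪gradient (fun w' => f w' v) w, p.1⟫ =
      fderiv ℝ (fun p : E × ℝ => f p.1 p.2) (w, v) (p.1, 0) := by
    rw [gradient, InnerProductSpace.toDual_symm_apply, h1.fderiv]; simp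
  have e2 : p.2 * deriv (fun t => f w t) v =
      fderiv ℝ (fun p : E × ℝ => f p.1 p.2) (w, v) (0, p.2) := by
    rw [← smul_eq_mul, ← fderiv_eq_smul_deriv, h2.fderiv]; simp
  simp only [ContinuousLinearMap.coprod_apply, innerSL_apply_apply,
    ContinuousLinearMap.toSpanSingleton_apply, smul_eq_mul]
  rw [e1, e2, ← map_add]
  simp

/-- The partial derivative in the real variable of a `C²` function is differentiable. -/
theorem ContDiff.differentiable_deriv_snd [NormedSpace ℝ E] {f : E → ℝ → ℝ}
    (hf : ContDiff ℝ 2 fun p : E × ℝ => f p.1 p.2) :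
    Differentiable ℝ fun p : E × ℝ => deriv (fun t => f p.1 t) p.2 := by
  have h : (fun p : E × ℝ => deriv (fun t => f p.1 t) p.2) =
      fun p => fderiv ℝ (fun p : E × ℝ => f p.1 p.2) p (0, 1) := by
    funext p
    have h1 := (hf.differentiable (by norm_num) (p.1, p.2)).hasFDerivAt
    have h2 := HasFDerivAt.comp (g := fun p : E × ℝ => f p.1 p.2) p.2 h1
      (hasFDerivAt_prodMk_right p.1 p.2)
    have h3 := h2.hasDerivAt.deriv
    simpa [Function.comp_def] using h3
  rw [h]
  exact ((hf.fderiv_right (m := 1) (by norm_num)).differentiable (by norm_num)).clm_apply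
    (differentiable_const _)

/-- First-order optimality condition for a ridge-regularized empirical risk. -/
theorem regularized_risk_stationary [Fintype ι] {f : ι → ℝ → ℝ} (hf : ∀ i, Differentiable ℝ (f i))
    (φ : ι → H) (c lam : ℝ) {h₀ : H}
    (hmin : ∀ h, c * (∑ i, f i ⟪h₀, φ i⟫) + lam / 2 * ‖h₀‖ ^ 2 ≤
      c * (∑ i, f i ⟪h, φ i⟫) + lam / 2 * ‖h‖ ^ 2) :
    lam • h₀ + c • ∑ i, deriv (f i) ⟪h₀, φ i⟫ • φ i = 0 := by
  set z := lam • h₀ + c • ∑ i, deriv (f i) ⟪h₀, φ i⟫ • φ i with hz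
  have hline : HasDerivAt (fun t : ℝ => h₀ + t • z) z 0 := by
    simpa using ((hasDerivAt_id (0 : ℝ)).smul_const z).const_add h₀
  have hJ : HasDerivAt (fun t : ℝ => c * (∑ i, f i ⟪h₀ + t • z, φ i⟫) +
      lam / 2 * ‖h₀ + t • z‖ ^ 2)
      (c * (∑ i, deriv (f i) ⟪h₀, φ i⟫ * ⟪z, φ i⟫) + lam / 2 * (2 * ⟪h₀, z⟫)) 0 := by
    refine HasDerivAt.add (HasDerivAt.const_mul c (HasDerivAt.fun_sum fun i _ => ?_))
      (HasDerivAt.const_mul _ ?_)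
    · have h1 : HasDerivAt (fun t : ℝ => ⟪h₀ + t • z, φ i⟫) ⟪z, φ i⟫ 0 := by
        simpa using hline.inner ℝ (hasDerivAt_const (0 : ℝ) (φ i))
      have h2 : HasDerivAt (f i) (deriv (f i) ⟪h₀, φ i⟫) ⟪h₀ + (0 : ℝ) • z, φ i⟫ := by
        simpa using (hf i ⟪h₀, φ i⟫).hasDerivAt
      exact h2.comp (0 : ℝ) h1
    · simpa using hline.norm_sq
  have hmin0 : IsLocalMin (fun t : ℝ => c * (∑ i, f i ⟪h₀ + t • z, φ i⟫) +
      lam / 2 * ‖h₀ + t • z‖ ^ 2) 0 :=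
    Filter.Eventually.of_forall fun t => by simpa using hmin (h₀ + t • z)
  have h0 := hmin0.hasDerivAt_eq_zero hJ
  have hzz : ⟪z, z⟫ = 0 := by
    rw [← h0]
    nth_rewrite 1 [hz]
    simp only [inner_add_left, real_inner_smul_left, sum_inner, real_inner_comm z (φ _)]
    ring
  exact inner_self_eq_zero.mp hzz

/-- Positive rank-one perturbations of a positive multiple of the identity are invertible. -/
theorem exists_equiv_smul_add_sum_inner_smul [CompleteSpace H] [Fintype ι] {b : ι → ℝ}
    (hb : ∀ i, 0 ≤ b i) (φ : ι → H) {c lam : ℝ} (hc : 0 ≤ c) (hlam : 0 < lam) :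
    ∃ A : H ≃L[ℝ] H, ∀ h, A h = lam • h + c • ∑ i, (b i * ⟪h, φ i⟫) • φ i := by
  let T : H →L[ℝ] H := lam • ContinuousLinearMap.id ℝ H +
    c • ∑ i, b i • (innerSL ℝ (φ i)).smulRight (φ i)
  have hT : ∀ h, T h = lam • h + c • ∑ i, (b i * ⟪h, φ i⟫) • φ i := fun h => by
    simp [T, smul_smul, real_inner_comm]
  have hco : IsCoercive ((innerSL ℝ).comp T) := by
    refine ⟨lam, hlam, fun u => ?_⟩
    rw [ContinuousLinearMap.comp_apply, innerSL_apply_apply, hT, inner_add_left,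
      real_inner_smul_left, real_inner_smul_left, sum_inner, real_inner_self_eq_norm_sq]
    have : 0 ≤ c * ∑ i, ⟪(b i * ⟪u, φ i⟫) • φ i, u⟫ := by
      refine mul_nonneg hc (Finset.sum_nonneg fun i _ => ?_)
      rw [real_inner_smul_left, real_inner_comm u, mul_assoc]
      exact mul_nonneg (hb i) (mul_self_nonneg _)
    nlinarith
  refine ⟨hco.continuousLinearEquivOfBilin, fun h => ?_⟩
  rw [← hT]
  exact (hco.unique_continuousLinearEquivOfBilin fun w => by simp).symm

/-- Completing the square in a ridge-regularized quadratic objective at a stationary point. -/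
theorem regularized_quadratic_add_sq_le {κ : Type*} [Fintype ι] [Fintype κ] {b : ι → ℝ}
    (hb : ∀ i, 0 ≤ b i) (φ : ι → H) (r : κ → ℝ) (ψ : κ → H) {c s lam : ℝ} (hc : 0 ≤ c) {a₀ : H}
    (h₀ : lam • a₀ + (2 * c) • ∑ i, (b i * ⟪a₀, φ i⟫) • φ i = -(s • ∑ j, r j • ψ j)) (a : H) :
    c * (∑ i, b i * ⟪a₀, φ i⟫ ^ 2) + s * (∑ j, r j * ⟪a₀, ψ j⟫) + lam / 2 * ‖a₀‖ ^ 2 +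
        lam / 2 * ‖a - a₀‖ ^ 2 ≤
      c * (∑ i, b i * ⟪a, φ i⟫ ^ 2) + s * (∑ j, r j * ⟪a, ψ j⟫) + lam / 2 * ‖a‖ ^ 2 := by
  obtain ⟨e, rfl⟩ : ∃ e, a = a₀ + e := ⟨a - a₀, by simp⟩
  have h1 := congrArg (fun z => ⟪z, e⟫) h₀
  simp only [inner_add_left, real_inner_smul_left, sum_inner, inner_neg_left,
    real_inner_comm e (φ _), real_inner_comm e (ψ _)] at h1
  have h2 : ∑ i, b i * ⟪a₀ + e, φ i⟫ ^ 2 = ∑ i, b i * ⟪a₀, φ i⟫ ^ 2 +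
      2 * ∑ i, b i * ⟪a₀, φ i⟫ * ⟪e, φ i⟫ + ∑ i, b i * ⟪e, φ i⟫ ^ 2 := by
    rw [Finset.mul_sum, ← Finset.sum_add_distrib, ← Finset.sum_add_distrib]
    refine Finset.sum_congr rfl fun i _ => ?_
    rw [inner_add_left]; ring
  have h3 : ∑ j, r j * ⟪a₀ + e, ψ j⟫ = ∑ j, r j * ⟪a₀, ψ j⟫ + ∑ j, r j * ⟪e, ψ j⟫ := by
    rw [← Finset.sum_add_distrib]
    refine Finset.sum_congr rfl fun i _ => ?_
    rw [inner_add_left]; ring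
  have h4 : 0 ≤ c * ∑ i, b i * ⟪e, φ i⟫ ^ 2 :=
    mul_nonneg hc (Finset.sum_nonneg fun i _ => mul_nonneg (hb i) (sq_nonneg _))
  rw [h2, h3, norm_add_sq_real, add_sub_cancel_left]
  linarith

/-- The gradient of a ridge-regularized convex empirical risk is strongly monotone. -/
theorem regularized_gradient_strongly_monotone [Fintype ι] {g : ι → ℝ → ℝ}
    (hg : ∀ i, Monotone (g i)) (φ : ι → H) {c : ℝ} (lam : ℝ) (hc : 0 ≤ c) (h k : H) :
    lam * ‖h - k‖ ^ 2 ≤ ⟪(lam • h + c • ∑ i, g i ⟪h, φ i⟫ • φ i) -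
      (lam • k + c • ∑ i, g i ⟪k, φ i⟫ • φ i), h - k⟫ := by
  have h1 : (lam • h + c • ∑ i, g i ⟪h, φ i⟫ • φ i) - (lam • k + c • ∑ i, g i ⟪k, φ i⟫ • φ i) =
      lam • (h - k) + c • ∑ i, (g i ⟪h, φ i⟫ - g i ⟪k, φ i⟫) • φ i := by
    simp only [sub_smul, Finset.sum_sub_distrib, smul_sub]
    abel
  rw [h1, inner_add_left, real_inner_smul_left, real_inner_smul_left, sum_inner,
    real_inner_self_eq_norm_sq]
  refine le_add_of_nonneg_right (mul_nonneg hc (Finset.sum_nonneg fun i _ => ?_))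
  rw [real_inner_smul_left, inner_sub_right, real_inner_comm h, real_inner_comm k]
  rcases le_total ⟪k, φ i⟫ ⟪h, φ i⟫ with hle | hle
  · exact mul_nonneg (sub_nonneg.2 (hg i hle)) (sub_nonneg.2 hle)
  · exact mul_nonneg_of_nonpos_of_nonpos (sub_nonpos.2 (hg i hle)) (sub_nonpos.2 hle)

end Helpers

/-- Context: `H` a real Hilbert space, `φ : X → H` measurable with
`‖φ x‖² ≤ κ` (so `h(x) := ⟪h, φ x⟫`), `Y ⊆ ℝ^q` compact, `ℓ_in, ℓ_out` of class `C³`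
jointly in `(ω, v)` with all partial derivatives up to order three jointly continuous,
`v ↦ ℓ_in(ω,v,y)` convex, `λ > 0`; given points `(x_i, y_i)_{i≤n}` and
`(x̃_j, ỹ_j)_{j≤m}` in `X × Y`, `L̂_out(ω,h) = (1/m)Σ_j ℓ_out(ω, h(x̃_j), ỹ_j)`,
`L̂_in(ω,h) = (1/n)Σ_i ℓ_in(ω, h(x_i), y_i) + (λ/2)‖h‖²`, and `ĥ_ω` the unique
minimizer of `L̂_in(ω, ·)`.
Conclusion: `F̂(ω) := L̂_out(ω, ĥ_ω)` is differentiable, with gradient equal to the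
plug-in estimator of the total gradient
`∇F̂(ω) = (1/m)Σ_j ∂_ω ℓ_out(ω, ĥ_ω(x̃_j), ỹ_j)
        + (1/n)Σ_i ∂²_{ω,v} ℓ_in(ω, ĥ_ω(x_i), y_i) â_ω(x_i)`,
where `â_ω` is the unique minimizer over `H` of the empirical adjoint objective
`a ↦ (1/2n)Σ_i ∂²_v ℓ_in(ω, ĥ_ω(x_i), y_i) a(x_i)²
   + (1/m)Σ_j ∂_v ℓ_out(ω, ĥ_ω(x̃_j), ỹ_j) a(x̃_j) + (λ/2)‖a‖²`. -/
theorem stmt_17 {d q : ℕ} {H X : Type*}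
    [NormedAddCommGroup H] [InnerProductSpace ℝ H] [CompleteSpace H]
    [MeasurableSpace X] [MeasurableSpace H] [BorelSpace H]
    (φ : X → H) (hφm : Measurable φ)
    (κ : ℝ) (hκ : 0 < κ) (hφb : ∀ x : X, ‖φ x‖ ^ 2 ≤ κ)
    (Y : Set (Euc q)) (hY : IsCompact Y)
    (ℓin ℓout : Euc d → ℝ → Euc q → ℝ)
    (hC3in : ∀ y : Euc q, ContDiff ℝ 3 fun p : Euc d × ℝ => ℓin p.1 p.2 y)
    (hC3out : ∀ y : Euc q, ContDiff ℝ 3 fun p : Euc d × ℝ => ℓout p.1 p.2 y)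
    (hjcin : ∀ i : ℕ, i ≤ 3 → Continuous fun p : (Euc d × ℝ) × Euc q =>
      iteratedFDeriv ℝ i (fun r : Euc d × ℝ => ℓin r.1 r.2 p.2) p.1)
    (hjcout : ∀ i : ℕ, i ≤ 3 → Continuous fun p : (Euc d × ℝ) × Euc q =>
      iteratedFDeriv ℝ i (fun r : Euc d × ℝ => ℓout r.1 r.2 p.2) p.1)
    (hconv : ∀ (ω : Euc d) (y : Euc q), ConvexOn ℝ Set.univ fun v : ℝ => ℓin ω v y)
    (lam : ℝ) (hlam : 0 < lam)
    (n m : ℕ)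
    (xs : Fin n → X) (ys : Fin n → Euc q) (hys : ∀ i, ys i ∈ Y)
    (xt : Fin m → X) (yt : Fin m → Euc q) (hyt : ∀ j, yt j ∈ Y)
    (hhat : Euc d → H)
    (hhatMin : ∀ (ω : Euc d) (h : H),
      (1 / (n : ℝ)) * (∑ i, ℓin ω ⟪hhat ω, φ (xs i)⟫ (ys i)) + lam / 2 * ‖hhat ω‖ ^ 2 ≤
        (1 / (n : ℝ)) * (∑ i, ℓin ω ⟪h, φ (xs i)⟫ (ys i)) + lam / 2 * ‖h‖ ^ 2) :
    ∀ ω : Euc d, ∃ aHat : H,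
      -- `â_ω` is the unique minimizer of the empirical adjoint objective
      (∀ a : H,
        (1 / (2 * (n : ℝ))) * (∑ i, (deriv (fun v : ℝ =>
              deriv (fun v' : ℝ => ℓin ω v' (ys i)) v) ⟪hhat ω, φ (xs i)⟫) *
            ⟪aHat, φ (xs i)⟫ ^ 2) +
          (1 / (m : ℝ)) * (∑ j, (deriv (fun v : ℝ => ℓout ω v (yt j)) ⟪hhat ω, φ (xt j)⟫) *
            ⟪aHat, φ (xt j)⟫) + lam / 2 * ‖aHat‖ ^ 2 ≤
        (1 / (2 * (n : ℝ))) * (∑ i, (deriv (fun v : ℝ =>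
              deriv (fun v' : ℝ => ℓin ω v' (ys i)) v) ⟪hhat ω, φ (xs i)⟫) *
            ⟪a, φ (xs i)⟫ ^ 2) +
          (1 / (m : ℝ)) * (∑ j, (deriv (fun v : ℝ => ℓout ω v (yt j)) ⟪hhat ω, φ (xt j)⟫) *
            ⟪a, φ (xt j)⟫) + lam / 2 * ‖a‖ ^ 2) ∧
      (∀ a : H,
        (∀ a' : H,
          (1 / (2 * (n : ℝ))) * (∑ i, (deriv (fun v : ℝ =>
                deriv (fun v' : ℝ => ℓin ω v' (ys i)) v) ⟪hhat ω, φ (xs i)⟫) *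
              ⟪a, φ (xs i)⟫ ^ 2) +
            (1 / (m : ℝ)) * (∑ j, (deriv (fun v : ℝ => ℓout ω v (yt j)) ⟪hhat ω, φ (xt j)⟫) *
              ⟪a, φ (xt j)⟫) + lam / 2 * ‖a‖ ^ 2 ≤
          (1 / (2 * (n : ℝ))) * (∑ i, (deriv (fun v : ℝ =>
                deriv (fun v' : ℝ => ℓin ω v' (ys i)) v) ⟪hhat ω, φ (xs i)⟫) *
              ⟪a', φ (xs i)⟫ ^ 2) +
            (1 / (m : ℝ)) * (∑ j, (deriv (fun v : ℝ => ℓout ω v (yt j)) ⟪hhat ω, φ (xt j)⟫) *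
              ⟪a', φ (xt j)⟫) + lam / 2 * ‖a'‖ ^ 2) → a = aHat) ∧
      -- differentiability of the empirical value function and the gradient identity
      HasGradientAt
        (fun ω' : Euc d => (1 / (m : ℝ)) * ∑ j, ℓout ω' ⟪hhat ω', φ (xt j)⟫ (yt j))
        ((1 / (m : ℝ)) •
            (∑ j, gradient (fun ω' : Euc d => ℓout ω' ⟪hhat ω, φ (xt j)⟫ (yt j)) ω) +
          (1 / (n : ℝ)) •
            (∑ i, ⟪aHat, φ (xs i)⟫ •
              gradient (fun ω' : Euc d =>
                deriv (fun v : ℝ => ℓin ω' v (ys i)) ⟪hhat ω, φ (xs i)⟫) ω))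
        ω := by
  intro ω
  have hc : (0 : ℝ) ≤ 1 / n := by positivity
  have hc2 : (0 : ℝ) ≤ 1 / (2 * n) := by positivity
  set g : Fin n → Euc d → ℝ → ℝ := fun i w v => deriv (fun v' : ℝ => ℓin w v' (ys i)) v
  have hdin : ∀ i w, Differentiable ℝ fun v => ℓin w v (ys i) := fun i w =>
    ((hC3in (ys i)).differentiable (by norm_num)).comp
      ((differentiable_const w).prodMk differentiable_id)
  have hgdiff : ∀ i, Differentiable ℝ fun p : Euc d × ℝ => g i p.1 p.2 := fun i =>
    ContDiff.differentiable_deriv_snd (f := fun w v => ℓin w v (ys i))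
      ((hC3in (ys i)).of_le (by norm_num))
  have hgmono : ∀ i w, Monotone (g i w) := fun i w =>
    monotoneOn_univ.1 ((hconv w (ys i)).monotoneOn_deriv fun v _ => hdin i w v)
  have hg' : ∀ i v, 0 ≤ deriv (g i ω) v := fun i v => (hgmono i ω).deriv_nonneg
  have hzero : ∀ w, lam • hhat w + (1 / (n : ℝ)) • ∑ i, g i w ⟪hhat w, φ (xs i)⟫ • φ (xs i) = 0 :=
    fun w => regularized_risk_stationary (f := fun i v => ℓin w v (ys i)) (fun i => hdin i w)
      (fun i => φ (xs i)) _ lam (hhatMin w)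
  obtain ⟨A, hA⟩ := exists_equiv_smul_add_sum_inner_smul
    (fun i => hg' i ⟪hhat ω, φ (xs i)⟫) (fun i => φ (xs i)) hc hlam
  set r : Fin m → ℝ := fun j => deriv (fun v : ℝ => ℓout ω v (yt j)) ⟪hhat ω, φ (xt j)⟫ with hr
  set D : Euc d →L[ℝ] H := (1 / (n : ℝ)) • ∑ i, (innerSL ℝ
    (gradient (fun w => g i w ⟪hhat ω, φ (xs i)⟫) ω)).smulRight (φ (xs i)) with hD
  have hder : HasFDerivAt hhat (-((A.symm : H →L[ℝ] H).comp D)) ω := by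
    refine hasFDerivAt_zero_of_strongly_monotone hlam (fun w h k =>
      regularized_gradient_strongly_monotone (fun i => hgmono i w) (fun i => φ (xs i)) lam hc h k)
      hzero ?_
    have hinner : ∀ i, HasFDerivAt (fun p : Euc d × H => (p.1, ⟪p.2, φ (xs i)⟫))
        ((ContinuousLinearMap.fst ℝ (Euc d) H).prod
          ((innerSL ℝ (φ (xs i))).comp (ContinuousLinearMap.snd ℝ (Euc d) H))) (ω, hhat ω) :=
      fun i => by
        have := ((innerSL ℝ (φ (xs i))).comp
          (ContinuousLinearMap.snd ℝ (Euc d) H)).hasFDerivAt (x := (ω, hhat ω))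
        refine hasFDerivAt_fst.prodMk (this.congr_of_eventuallyEq ?_)
        exact Filter.Eventually.of_forall fun p => real_inner_comm _ _
    have hsum := ((hasFDerivAt_snd (𝕜 := ℝ) (p := (ω, hhat ω))).const_smul lam).add
      ((HasFDerivAt.fun_sum (u := Finset.univ) fun i _ =>
        (HasFDerivAt.comp (g := fun p : Euc d × ℝ => g i p.1 p.2) (ω, hhat ω)
          (hasFDerivAt_coprod_gradient_deriv (hgdiff i _)) (hinner i)).smul_const
            (φ (xs i))).const_smul (1 / (n : ℝ)))
    refine hsum.congr_fderiv (ContinuousLinearMap.ext fun p => ?_)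
    simp only [ContinuousLinearMap.coprod_apply, ContinuousLinearEquiv.coe_coe, hA, hD]
    simp [add_smul, Finset.sum_add_distrib, smul_add,
      real_inner_comm, mul_comm]
    abel
  obtain ⟨a₀, hAa₀⟩ := A.surjective (-((1 / (m : ℝ)) • ∑ j, r j • φ (xt j)))
  have hquad := regularized_quadratic_add_sq_le (fun i => hg' i ⟪hhat ω, φ (xs i)⟫)
    (fun i => φ (xs i)) r (fun j => φ (xt j)) (s := 1 / (m : ℝ)) (lam := lam) hc2 (a₀ := a₀) (by
      rw [← hAa₀, hA]
      congr 2
      ring)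
  refine ⟨a₀, fun a => ?_, fun a ha => ?_, ?_⟩
  · have : 0 ≤ lam / 2 * ‖a - a₀‖ ^ 2 := by positivity
    linarith [hquad a]
  · have h1 : lam / 2 * ‖a - a₀‖ ^ 2 ≤ 0 := by linarith [hquad a, ha a₀]
    have h2 : ‖a - a₀‖ ^ 2 ≤ 0 := by nlinarith
    exact sub_eq_zero.1 (norm_eq_zero.1 (pow_eq_zero_iff (two_ne_zero) |>.1
      (le_antisymm h2 (sq_nonneg _))))
  · have hout : ∀ j, HasFDerivAt (fun w => ℓout w ⟪hhat w, φ (xt j)⟫ (yt j))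
        (innerSL ℝ (gradient (fun w => ℓout w ⟪hhat ω, φ (xt j)⟫ (yt j)) ω) +
          r j • (innerSL ℝ (φ (xt j))).comp (-((A.symm : H →L[ℝ] H).comp D))) ω := fun j => by
      have h1 : HasFDerivAt (fun w => ⟪hhat w, φ (xt j)⟫)
          ((innerSL ℝ (φ (xt j))).comp (-((A.symm : H →L[ℝ] H).comp D))) ω := by
        refine ((innerSL ℝ (φ (xt j))).hasFDerivAt.comp ω hder).congr_of_eventuallyEq ?_
        exact Filter.Eventually.of_forall fun w => real_inner_comm _ _
      have h2 := HasFDerivAt.comp (g := fun p : Euc d × ℝ => ℓout p.1 p.2 (yt j)) ω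
        (hasFDerivAt_coprod_gradient_deriv (f := fun w v => ℓout w v (yt j))
          ((hC3out (yt j)).differentiable (by norm_num) _)) ((hasFDerivAt_id ω).prodMk h1)
      refine h2.congr_fderiv (ContinuousLinearMap.ext fun u => ?_)
      simp [hr, mul_comm]
    rw [hasGradientAt_iff_hasFDerivAt]
    refine ((HasFDerivAt.fun_sum (u := Finset.univ) fun j _ => hout j).const_mul
      (1 / (m : ℝ))).congr_fderiv (ContinuousLinearMap.ext fun u => ?_)
    have hsymm : ∀ x y, ⟪A x, y⟫ = ⟪x, A y⟫ := fun x y => by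
      simp only [hA, inner_add_left, inner_add_right, real_inner_smul_left,
        real_inner_smul_right, sum_inner, inner_sum]
      congr 2
      refine Finset.sum_congr rfl fun i _ => ?_
      rw [real_inner_comm y]
      ring
    have hadj : ⟪a₀, D u⟫ = -((1 / (m : ℝ)) * ∑ j, r j * ⟪φ (xt j), A.symm (D u)⟫) := by
      have h1 := hsymm a₀ (A.symm (D u))
      rw [ContinuousLinearEquiv.apply_symm_apply, hAa₀] at h1
      rw [← h1]
      simp only [inner_neg_left, real_inner_smul_left, sum_inner]
    have hDu : ⟪a₀, D u⟫ = (1 / (n : ℝ)) * ∑ i, ⟪a₀, φ (xs i)⟫ *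
        ⟪gradient (fun w => g i w ⟪hhat ω, φ (xs i)⟫) ω, u⟫ := by
      simp only [hD, smul_apply, sum_apply,
        ContinuousLinearMap.smulRight_apply, innerSL_apply_apply, real_inner_smul_right, inner_sum]
      simp only [mul_comm]
    rw [InnerProductSpace.toDual_apply_apply]
    simp only [inner_add_left, real_inner_smul_left, sum_inner]
    rw [← hDu, hadj]
    simp [Finset.sum_add_distrib]
end
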